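/- Let S be a profinite semigroup with minimum ideal K, and assume S is generalized group mapping (GGM), i.e., both maps s ↦ λ^K_s and s ↦ ρ^K_s are injective on S. Then the translational hull Ω(K), with the compact-open topology, is a profinite semigroup. -/

import Mathlib

open Filter Topology

section Hull

variable {T : Type*} [Semigroup T] [TopologicalSpace T]

/-- A left translation of a topological semigroup. -/
def IsLeftTranslation (l : C(T, T)) : Prop :=
  ∀ s t : T, l (s * t) = l s * t

/-- A right translation of a topological semigroup. -/
def IsRightTranslation (r : C(T, T)) : Prop :=
  ∀ s t : T, r (s * t) = s * r t

/-- A bitranslation: a linked pair of a left and a right translation. -/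
def IsBitranslation (p : C(T, T) × C(T, T)) : Prop :=
  IsLeftTranslation p.1 ∧ IsRightTranslation p.2 ∧ ∀ s t : T, s * p.1 t = p.2 s * t

/-- The translational hull of a topological semigroup, topologized as a subspace of
`C(T,T) × C(T,T)` where both factors carry the compact-open topology. -/
abbrev TranslationalHull (T : Type*) [Semigroup T] [TopologicalSpace T] :=
  { p : C(T, T) × C(T, T) // IsBitranslation p }

instance : Mul (TranslationalHull T) where
  mul p q :=
    ⟨(p.1.1.comp q.1.1, q.1.2.comp p.1.2), by
      obtain ⟨⟨l₁, r₁⟩, hL₁, hR₁, hk₁⟩ := p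
      obtain ⟨⟨l₂, r₂⟩, hL₂, hR₂, hk₂⟩ := q
      refine ⟨fun s t => ?_, fun s t => ?_, fun s t => ?_⟩
      · simp only [ContinuousMap.comp_apply]
        rw [hL₂, hL₁]
      · simp only [ContinuousMap.comp_apply]
        rw [hR₁, hR₂]
      · simp only [ContinuousMap.comp_apply]
        rw [hk₁, hk₂]⟩

end Hull

section

variable {S : Type*} [Semigroup S] [TopologicalSpace S] [ContinuousMul S]

/-- An ideal of a semigroup: a nonempty subset closed under multiplication by arbitrary
elements on both sides. -/
def IsIdeal (I : Set S) : Prop :=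
  I.Nonempty ∧ ∀ s : S, ∀ x ∈ I, s * x ∈ I ∧ x * s ∈ I

/-- Left multiplication by `s` restricted to an ideal `K`, as a continuous self-map of `K`. -/
def lamK (K : Subsemigroup S) (hl : ∀ s : S, ∀ x ∈ K, s * x ∈ K) (s : S) : C(K, K) :=
  ⟨fun x => ⟨s * x, hl s x x.2⟩,
    Continuous.subtype_mk (Continuous.mul continuous_const continuous_subtype_val) _⟩

/-- Right multiplication by `s` restricted to an ideal `K`, as a continuous self-map of `K`. -/
def rhoK (K : Subsemigroup S) (hr : ∀ s : S, ∀ x ∈ K, x * s ∈ K) (s : S) : C(K, K) :=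
  ⟨fun x => ⟨x * s, hr s x x.2⟩,
    Continuous.subtype_mk (Continuous.mul continuous_subtype_val continuous_const) _⟩

end

section LinkedPairs

variable {T : Type*} [Semigroup T] [TopologicalSpace T]

/-- The linked pairs of arbitrary (not necessarily continuous) self-maps of a semigroup. -/
def linkedPairs (T : Type*) [Semigroup T] : Set ((T → T) × (T → T)) :=
  { p | ∀ s t : T, s * p.1 t = p.2 s * t }

theorem isClosed_linkedPairs [ContinuousMul T] [T2Space T] : IsClosed (linkedPairs T) := by
  simp only [linkedPairs, Set.ofPred_forall]
  refine isClosed_iInter fun s => isClosed_iInter fun t => isClosed_eq ?_ ?_ <;> fun_prop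

/-- If the points of a compact semigroup are separated by left multiplications, continuity of a
map into it can be tested after left multiplication by each element. -/
theorem continuous_of_forall_mul_left [ContinuousMul T] [CompactSpace T] [T2Space T]
    (hT : ∀ x y : T, (∀ s, s * x = s * y) → x = y) {X : Type*} [TopologicalSpace X] {f : X → T}
    (hf : ∀ s, Continuous fun x => s * f x) : Continuous f := by
  have hemb : IsClosedEmbedding fun x s : T => s * x :=
    Continuous.isClosedEmbedding (by fun_prop) fun x y h => hT x y (congrFun h)
  exact hemb.isInducing.continuous_iff.2 (continuous_pi hf)

/-- If the points of a compact semigroup are separated by right multiplications, continuity of a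
map into it can be tested after right multiplication by each element. -/
theorem continuous_of_forall_mul_right [ContinuousMul T] [CompactSpace T] [T2Space T]
    (hT : ∀ x y : T, (∀ s, x * s = y * s) → x = y) {X : Type*} [TopologicalSpace X] {f : X → T}
    (hf : ∀ s, Continuous fun x => f x * s) : Continuous f := by
  have hemb : IsClosedEmbedding fun x s : T => x * s :=
    Continuous.isClosedEmbedding (by fun_prop) fun x y h => hT x y (congrFun h)
  exact hemb.isInducing.continuous_iff.2 (continuous_pi hf)

/-- The translational hull of a reductive compact Hausdorff semigroup is compact: it is a
continuous image of the space of linked pairs with the topology of pointwise convergence. -/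
theorem compactSpace_translationalHull [ContinuousMul T] [CompactSpace T] [T2Space T]
    (hleft : ∀ x y : T, (∀ s, x * s = y * s) → x = y)
    (hright : ∀ x y : T, (∀ s, s * x = s * y) → x = y) :
    CompactSpace (TranslationalHull T) := by
  have : CompactSpace (linkedPairs T) :=
    isCompact_iff_compactSpace.1 isClosed_linkedPairs.isCompact
  have hcont₁ : Continuous fun q : linkedPairs T × T => q.1.1.1 q.2 := by
    refine continuous_of_forall_mul_left hright fun s => ?_
    simp only [fun q : linkedPairs T × T => q.1.2 s q.2]
    fun_prop
  have hcont₂ : Continuous fun q : linkedPairs T × T => q.1.1.2 q.2 := by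
    refine continuous_of_forall_mul_right hleft fun t => ?_
    simp only [← fun q : linkedPairs T × T => q.1.2 q.2 t]
    fun_prop
  let l : C(linkedPairs T, C(T, T)) := ContinuousMap.curry ⟨_, hcont₁⟩
  let r : C(linkedPairs T, C(T, T)) := ContinuousMap.curry ⟨_, hcont₂⟩
  have hbi (p : linkedPairs T) : IsBitranslation (l p, r p) := by
    refine ⟨fun s t => hright _ _ fun u => ?_, fun s t => hleft _ _ fun u => ?_, p.2⟩
    · change u * p.1.1 (s * t) = u * (p.1.1 s * t)
      rw [p.2, ← mul_assoc, ← mul_assoc, p.2]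
    · change p.1.2 (s * t) * u = s * p.1.2 t * u
      rw [← p.2, mul_assoc, mul_assoc, p.2]
  let F : linkedPairs T → TranslationalHull T := fun p => ⟨(l p, r p), hbi p⟩
  have hF : Continuous F := by fun_prop
  have hsurj : Function.Surjective F := fun p => ⟨⟨(p.1.1, p.1.2), p.2.2.2⟩, rfl⟩
  exact hsurj.compactSpace hF

theorem totallyDisconnectedSpace_translationalHull [TotallyDisconnectedSpace T] :
    TotallyDisconnectedSpace (TranslationalHull T) := by
  let G : TranslationalHull T → (T → T) × (T → T) := fun p => (p.1.1, p.1.2)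
  have hG : Continuous G := by fun_prop
  have hinj : Function.Injective G := fun p q h =>
    Subtype.ext (Prod.ext (DFunLike.coe_injective (congrArg Prod.fst h))
      (DFunLike.coe_injective (congrArg Prod.snd h)))
  exact ⟨fun _ _ hs => (isTotallyDisconnected_of_image hG.continuousOn hinj
    (isTotallyDisconnected_of_totallyDisconnectedSpace _)) _ subset_rfl hs⟩

theorem continuous_mul_translationalHull [LocallyCompactSpace T] :
    Continuous fun p : TranslationalHull T × TranslationalHull T => p.1 * p.2 :=
  Continuous.subtype_mk (f := fun p : TranslationalHull T × TranslationalHull T =>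
    (p.1.1.1.comp p.2.1.1, p.2.1.2.comp p.1.1.2))
    (.prodMk (.compCM (by fun_prop) (by fun_prop)) (.compCM (by fun_prop) (by fun_prop))) _

end LinkedPairs

/-- If a profinite semigroup `S` with minimum closed ideal `K` is generalized group mapping
(GGM), i.e. both `s ↦ λ^K_s` and `s ↦ ρ^K_s` are injective, then the translational hull
`Ω(K)`, with the compact-open topology, is a profinite semigroup: compact, Hausdorff,
zero-dimensional, with continuous multiplication. -/
theorem translationalHull_of_minimal_ideal_profinite_of_ggm
    {S : Type*} [Semigroup S] [TopologicalSpace S] [ContinuousMul S]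
    [CompactSpace S] [T2Space S] [TotallyDisconnectedSpace S]
    (K : Subsemigroup S) (hKideal : IsIdeal (K : Set S)) (hKclosed : IsClosed (K : Set S))
    (hKmin : ∀ J : Set S, IsIdeal J → (K : Set S) ⊆ J)
    (hl : ∀ s : S, ∀ x ∈ K, s * x ∈ K) (hr : ∀ s : S, ∀ x ∈ K, x * s ∈ K)
    (hggm_left : Function.Injective (lamK K hl))
    (hggm_right : Function.Injective (rhoK K hr)) :
    CompactSpace (TranslationalHull K) ∧ T2Space (TranslationalHull K) ∧
      TotallyDisconnectedSpace (TranslationalHull K) ∧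
      Continuous (fun p : TranslationalHull K × TranslationalHull K => p.1 * p.2) := by
  have : CompactSpace K := isCompact_iff_compactSpace.1 hKclosed.isCompact
  have hleft (x y : K) (h : ∀ s, x * s = y * s) : x = y :=
    Subtype.ext (hggm_left (ContinuousMap.ext h))
  have hright (x y : K) (h : ∀ s, s * x = s * y) : x = y :=
    Subtype.ext (hggm_right (ContinuousMap.ext h))
  exact ⟨compactSpace_translationalHull hleft hright, inferInstance,
    totallyDisconnectedSpace_translationalHull, continuous_mul_translationalHull⟩
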